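/- arXiv:math-ph/0405040 — 6 statements merged into one kernel-verified Lean document; each statement's English description precedes it below -/
import Mathlib

section
/- Let p, q be natural numbers. If p + q is even, the center of the ℝ-algebra Cl_{p,q} is exactly ℝ·1 (the bottom subalgebra); if p + q is odd, the center of Cl_{p,q} is exactly the ℝ-linear span of {1, ω}, i.e. the subalgebra generated by the volume element ω. -/
open CliffordAlgebra

/-- The diagonal quadratic form of signature `(p, q)` on `ℝ^(p+q)`. -/
noncomputable def Qpq (p q : ℕ) : QuadraticForm ℝ (Fin (p + q) → ℝ) :=
  QuadraticMap.weightedSumSquares ℝ (fun i : Fin (p + q) => if (i : ℕ) < p then (1 : ℝ) else -1)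

/-- The volume element `ω = ι e₀ ⋯ ι e_{p+q-1}` of `Cl_{p,q}`. -/
noncomputable def omegaPQ (p q : ℕ) : CliffordAlgebra (Qpq p q) :=
  (List.ofFn fun i : Fin (p + q) => ι (Qpq p q) (Pi.single i 1)).prod

/-- A family of pairwise anticommuting elements of a `K`-algebra with nonzero scalar squares. -/
structure IsAnticommutingFamily {K A ι : Type*} [Field K] [Ring A] [Algebra K A]
    (ε : ι → K) (e : ι → A) : Prop where
  sq : ∀ i, e i * e i = algebraMap K A (ε i)
  ne_zero : ∀ i, ε i ≠ 0
  anticomm : ∀ i j, i ≠ j → e i * e j = -(e j * e i)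

namespace IsAnticommutingFamily

variable {K A ι : Type*} [Field K] [Ring A] [Algebra K A] {ε : ι → K} {e : ι → A}

theorem mul_prod [DecidableEq ι] (h : IsAnticommutingFamily ε e) (i : ι) (l : List ι) :
    e i * (l.map e).prod = (-1 : K) ^ (l.length + l.count i) • ((l.map e).prod * e i) := by
  induction l with
  | nil => simp
  | cons a t ih =>
    rw [List.map_cons, List.prod_cons, List.length_cons]
    by_cases hai : a = i
    · subst hai
      rw [List.count_cons_self, mul_assoc, ih, mul_smul_comm,
        show t.length + 1 + (t.count a + 1) = t.length + t.count a + 2 by ring, pow_add _ _ 2]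
      simp
    · rw [List.count_cons_of_ne hai, ← mul_assoc, h.anticomm i a (Ne.symm hai), neg_mul,
        mul_assoc, ih, mul_smul_comm, mul_assoc,
        show t.length + 1 + t.count i = t.length + t.count i + 1 by ring, pow_succ]
      simp

theorem exists_prod_eq_smul_of_perm (h : IsAnticommutingFamily ε e) {l₁ l₂ : List ι}
    (hl : l₁.Perm l₂) : ∃ c : K, c ≠ 0 ∧ (l₁.map e).prod = c • (l₂.map e).prod := by
  induction hl with
  | nil => exact ⟨1, one_ne_zero, by simp⟩
  | cons a _ ih =>
    obtain ⟨c, hc, hcl⟩ := ih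
    exact ⟨c, hc, by simp [hcl]⟩
  | swap a b l =>
    by_cases hab : b = a
    · subst hab
      exact ⟨1, one_ne_zero, by simp⟩
    · refine ⟨-1, neg_ne_zero.2 one_ne_zero, ?_⟩
      simp [← mul_assoc, h.anticomm b a hab]
  | trans _ _ ih₁ ih₂ =>
    obtain ⟨c, hc, hcl⟩ := ih₁
    obtain ⟨d, hd, hdl⟩ := ih₂
    exact ⟨c * d, mul_ne_zero hc hd, by rw [hcl, hdl, mul_smul]⟩

theorem exists_prod_eq_algebraMap [DecidableEq ι] (h : IsAnticommutingFamily ε e) (l : List ι)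
    (hl : ∀ i, Even (l.count i)) : ∃ c : K, c ≠ 0 ∧ (l.map e).prod = algebraMap K A c := by
  induction hn : l.length using Nat.strong_induction_on generalizing l with
  | _ n ih =>
    cases l with
    | nil => exact ⟨1, one_ne_zero, by simp⟩
    | cons a t =>
      have ha : a ∈ t := by
        have := hl a
        rw [List.count_cons_self, Nat.even_add_one] at this
        by_contra hat
        simp [List.count_eq_zero_of_not_mem hat] at this
      have hp : (a :: t).Perm (a :: a :: t.erase a) := (List.perm_cons_erase ha).cons a
      obtain ⟨c, hc, hcl⟩ := h.exists_prod_eq_smul_of_perm hp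
      have hcount (i : ι) : Even ((t.erase a).count i) := by
        have := hl i
        rw [hp.count_eq] at this
        by_cases hai : a = i
        · subst hai
          simpa [Nat.even_add_one] using this
        · simpa [List.count_cons_of_ne hai] using this
      have hlen := hp.length_eq
      simp only [List.length_cons] at hlen hn
      obtain ⟨d, hd, hdl⟩ := ih _ (by omega) (t.erase a) hcount rfl
      refine ⟨c * (ε a * d), mul_ne_zero hc (mul_ne_zero (h.ne_zero a) hd), ?_⟩
      rw [hcl, List.map_cons, List.map_cons, List.prod_cons, List.prod_cons, ← mul_assoc, h.sq,
        hdl, ← map_mul, Algebra.smul_def, ← map_mul]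

theorem mem_span_prod (he : Algebra.adjoin K (Set.range e) = ⊤) (x : A) :
    x ∈ Submodule.span K (Set.range fun l : List ι => (l.map e).prod) := by
  have hx : x ∈ Algebra.adjoin K (Set.range e) := he ▸ Algebra.mem_top
  rw [← Subalgebra.mem_toSubmodule, Algebra.adjoin_eq_span] at hx
  refine Submodule.span_mono ?_ hx
  intro y hy
  induction hy using Submonoid.closure_induction with
  | mem y hy =>
    obtain ⟨i, rfl⟩ := hy
    exact ⟨[i], by simp⟩
  | one => exact ⟨[], by simp⟩
  | mul y z _ _ hy hz =>
    obtain ⟨l, rfl⟩ := hy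
    obtain ⟨m, rfl⟩ := hz
    exact ⟨l ++ m, by simp⟩

theorem mem_span_prod_of_mem_center [DecidableEq ι] (h : IsAnticommutingFamily ε e)
    (h2 : (2 : K) ≠ 0) (he : Algebra.adjoin K (Set.range e) = ⊤) {z : A}
    (hz : z ∈ Subalgebra.center K A) (s : Finset ι) :
    z ∈ Submodule.span K
      ((fun l : List ι => (l.map e).prod) '' {l | ∀ i ∈ s, Even (l.length + l.count i)}) := by
  induction s using Finset.induction_on with
  | empty => simpa using mem_span_prod he z
  | insert i s _ ih =>
    -- Average over conjugation by `e i`, which fixes `z` and kills what anticommutes with `e i`.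
    let P : A →ₗ[K] A := (2 : K)⁻¹ • (LinearMap.id +
      (ε i)⁻¹ • (LinearMap.mulLeft K (e i) ∘ₗ LinearMap.mulRight K (e i)))
    have hP (x : A) (c : K) (hx : e i * x = c • (x * e i)) : P x = ((2 : K)⁻¹ * (1 + c)) • x := by
      have : e i * (x * e i) = (c * ε i) • x := by
        rw [← mul_assoc, hx, smul_mul_assoc, mul_assoc, h.sq, ← Algebra.commutes,
          ← Algebra.smul_def, mul_smul]
      simp only [P, LinearMap.smul_apply, LinearMap.add_apply, LinearMap.id_apply,
        LinearMap.comp_apply, LinearMap.mulLeft_apply, LinearMap.mulRight_apply, this]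
      rw [smul_smul, mul_comm c, inv_mul_cancel_left₀ (h.ne_zero i), mul_smul, add_smul, one_smul]
    have hPz : P z = z := by
      rw [hP z 1 (by rw [one_smul, Subalgebra.mem_center_iff.1 hz]), one_add_one_eq_two,
        inv_mul_cancel₀ h2, one_smul]
    rw [← hPz]
    refine (Submodule.map_span_le P _ _).2 ?_ (Submodule.mem_map_of_mem ih)
    rintro _ ⟨l, hl, rfl⟩
    rw [hP _ _ (h.mul_prod i l)]
    rcases Nat.even_or_odd (l.length + l.count i) with hi | hi
    · refine Submodule.smul_mem _ _ (Submodule.subset_span ⟨l, ?_, rfl⟩)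
      intro j hj
      rcases Finset.mem_insert.1 hj with rfl | hj
      exacts [hi, hl j hj]
    · simp [hi.neg_one_pow]

theorem even_count_or_odd [Fintype ι] [DecidableEq ι] {l : List ι}
    (hl : ∀ i, Even (l.length + l.count i)) :
    (∀ i, Even (l.count i)) ∨ Odd (Fintype.card ι) ∧ ∀ i, Odd (l.count i) := by
  rcases Nat.even_or_odd l.length with hlen | hlen
  · exact Or.inl fun i => (Nat.even_add.1 (hl i)).1 hlen
  · have hodd (i : ι) : Odd (l.count i) := by
      rw [← Nat.not_even_iff_odd] at hlen ⊢
      exact fun hi => hlen ((Nat.even_add.1 (hl i)).2 hi)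
    refine Or.inr ⟨?_, hodd⟩
    have hsum : ∑ i, l.count i = l.length := by
      simpa using Multiset.sum_count_eq_card (s := Finset.univ) (m := (l : Multiset ι)) (by simp)
    rw [← hsum, Finset.odd_sum_iff_odd_card_odd] at hlen
    simpa [hodd] using hlen

theorem center_eq_bot [Fintype ι] (h : IsAnticommutingFamily ε e) (h2 : (2 : K) ≠ 0)
    (he : Algebra.adjoin K (Set.range e) = ⊤) (hn : Even (Fintype.card ι)) :
    Subalgebra.center K A = ⊥ := by
  classical
  refine le_antisymm (fun z hz => ?_) bot_le
  rw [← Subalgebra.mem_toSubmodule]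
  refine Submodule.span_le.2 ?_ (h.mem_span_prod_of_mem_center h2 he hz Finset.univ)
  rintro _ ⟨l, hl, rfl⟩
  rcases even_count_or_odd (fun i => hl i (Finset.mem_univ i)) with hl | ⟨hodd, -⟩
  · obtain ⟨c, -, hc⟩ := h.exists_prod_eq_algebraMap l hl
    exact Algebra.mem_bot.2 ⟨c, hc.symm⟩
  · exact absurd hn (Nat.not_even_iff_odd.2 hodd)

theorem center_eq_adjoin [Fintype ι] [DecidableEq ι] (h : IsAnticommutingFamily ε e)
    (h2 : (2 : K) ≠ 0) (he : Algebra.adjoin K (Set.range e) = ⊤) (hn : Odd (Fintype.card ι))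
    {m : List ι} (hm : ∀ i, m.count i = 1) :
    Subalgebra.center K A = Algebra.adjoin K {(m.map e).prod} := by
  have hlen : m.length = Fintype.card ι := by
    have := Multiset.sum_count_eq_card (s := Finset.univ) (m := (m : Multiset ι)) (by simp)
    simpa [hm] using this.symm
  refine le_antisymm (fun z hz => ?_) (Algebra.adjoin_le (Set.singleton_subset_iff.2 ?_))
  · rw [← Subalgebra.mem_toSubmodule]
    refine Submodule.span_le.2 ?_ (h.mem_span_prod_of_mem_center h2 he hz Finset.univ)
    rintro _ ⟨l, hl, rfl⟩
    rcases even_count_or_odd (fun i => hl i (Finset.mem_univ i)) with hl | ⟨-, hl⟩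
    · obtain ⟨c, -, hc⟩ := h.exists_prod_eq_algebraMap l hl
      simp only [hc]
      exact Subalgebra.algebraMap_mem _ c
    · obtain ⟨c, -, hc⟩ := h.exists_prod_eq_algebraMap (l ++ m) fun i => by
        simpa [hm] using (hl i).add_one
      obtain ⟨d, hd, hdm⟩ := h.exists_prod_eq_algebraMap (m ++ m) fun i => by simp [hm]
      rw [List.map_append, List.prod_append] at hc hdm
      have key : (l.map e).prod = (d⁻¹ * c) • (m.map e).prod := by
        rw [mul_smul, Algebra.smul_def c, ← hc, mul_assoc, hdm, ← Algebra.commutes,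
          ← Algebra.smul_def, smul_smul, inv_mul_cancel₀ hd, one_smul]
      simp only [key]
      exact Subalgebra.smul_mem _ (Algebra.self_mem_adjoin_singleton K _) _
  · have hcomm : Algebra.adjoin K (Set.range e) ≤ Subalgebra.centralizer K {(m.map e).prod} := by
      refine Algebra.adjoin_le ?_
      rintro _ ⟨i, rfl⟩
      rw [SetLike.mem_coe, Subalgebra.mem_centralizer_iff]
      rintro _ rfl
      rw [h.mul_prod, hlen, hm, hn.add_one.neg_one_pow, one_smul]
    rw [SetLike.mem_coe, Subalgebra.mem_center_iff]
    intro b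
    have hb := hcomm (he ▸ Algebra.mem_top : b ∈ _)
    exact (Subalgebra.mem_centralizer_iff K |>.1 hb _ rfl).symm

end IsAnticommutingFamily

theorem isAnticommutingFamily_ι_single (p q : ℕ) :
    IsAnticommutingFamily (fun i : Fin (p + q) => if (i : ℕ) < p then (1 : ℝ) else -1)
      (fun i => ι (Qpq p q) (Pi.single i 1)) where
  sq i := by
    rw [ι_sq_scalar, Qpq, QuadraticMap.weightedSumSquares_apply]
    simp [Pi.single_apply]
  ne_zero i := by split_ifs <;> norm_num
  anticomm i j hij := by
    rw [eq_neg_iff_add_eq_zero, ι_mul_ι_add_swap]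
    suffices QuadraticMap.polar (Qpq p q) (Pi.single i 1) (Pi.single j 1) = 0 by
      rw [this, map_zero]
    simp only [QuadraticMap.polar, Qpq, QuadraticMap.weightedSumSquares_apply,
      ← Finset.sum_sub_distrib]
    refine Finset.sum_eq_zero fun k _ => ?_
    rcases eq_or_ne k i with rfl | hki
    · simp [hij]
    · simp [hki]

theorem adjoin_range_ι_single (p q : ℕ) :
    Algebra.adjoin ℝ (Set.range fun i => ι (Qpq p q) (Pi.single i 1)) = ⊤ := by
  rw [← top_le_iff, ← adjoin_range_ι]
  refine Algebra.adjoin_le ?_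
  rintro _ ⟨v, rfl⟩
  rw [pi_eq_sum_univ' v, map_sum]
  refine Subalgebra.sum_mem _ fun i _ => ?_
  rw [map_smul]
  exact Subalgebra.smul_mem _ (Algebra.subset_adjoin (Set.mem_range_self i)) _

theorem stmt_2 (p q : ℕ) :
    (Even (p + q) →
      Subalgebra.center ℝ (CliffordAlgebra (Qpq p q)) = ⊥) ∧
    (Odd (p + q) →
      Subalgebra.center ℝ (CliffordAlgebra (Qpq p q)) = Algebra.adjoin ℝ {omegaPQ p q}) := by
  constructor
  · intro hn
    exact (isAnticommutingFamily_ι_single p q).center_eq_bot two_ne_zero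
      (adjoin_range_ι_single p q) (by simpa using hn)
  · intro hn
    rw [(isAnticommutingFamily_ι_single p q).center_eq_adjoin two_ne_zero
      (adjoin_range_ι_single p q) (by simpa using hn) (m := List.finRange (p + q))
      (fun i => List.count_eq_one_of_mem (List.nodup_finRange _) (List.mem_finRange i)),
      omegaPQ, List.ofFn_eq_map]
end

section
/- The group G(2,0), i.e. the subgroup of the unit group of the Clifford algebra Cl_{2,0} (of the positive definite form on ℝ²) generated by −1, ι(e_0) and ι(e_1), is isomorphic to the dihedral group of order 8 (Lean: DihedralGroup 4). -/
open CliffordAlgebra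

/-- The finite group `G(p,q)`: the subgroup of the unit group of `Cl_{p,q}` generated by
`-1` together with the units `ι(e_i)`. -/
noncomputable def Gpq (p q : ℕ) : Subgroup (CliffordAlgebra (Qpq p q))ˣ :=
  Subgroup.closure {u : (CliffordAlgebra (Qpq p q))ˣ |
    (u : CliffordAlgebra (Qpq p q)) = -1 ∨
      ∃ i : Fin (p + q), (u : CliffordAlgebra (Qpq p q)) = ι (Qpq p q) (Pi.single i 1)}

/-- The homomorphism out of a dihedral group sending `r 1` to `c` and `sr 0` to `a`, for an
element `a` of order dividing two which inverts an element `c` of order dividing `n`. -/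
def DihedralGroup.liftHom {G : Type*} [Group G] (n : ℕ) (a c : G) (ha : a * a = 1)
    (hc : c ^ n = 1) (hac : a * c * a = c⁻¹) : DihedralGroup n →* G :=
  let f : ZMod n →+ Additive G :=
    ZMod.lift n ⟨zmultiplesHom (Additive G) (Additive.ofMul c), by
      simpa using congrArg Additive.ofMul hc⟩
  have hf (i : ZMod n) : (f i).toMul * a = a * (f (-i)).toMul := by
    obtain ⟨k, rfl⟩ := ZMod.intCast_surjective i
    have h : SemiconjBy a c⁻¹ c := by
      rw [SemiconjBy, ← hac, ← mul_assoc, ← mul_assoc, ha, one_mul]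
    have hk := (h.zpow_right k).eq
    rw [← Int.cast_neg]
    simpa [f, -Int.cast_neg] using hk.symm
  { toFun := fun
      | .r i => (f i).toMul
      | .sr i => a * (f i).toMul
    map_one' := by
      change (f 0).toMul = 1
      simp
    map_mul' := by
      rintro (i | i) (j | j)
      · change (f (i + j)).toMul = (f i).toMul * (f j).toMul
        simp
      · change a * (f (j - i)).toMul = (f i).toMul * (a * (f j).toMul)
        rw [← mul_assoc, hf, mul_assoc, ← toMul_add, ← map_add, neg_add_eq_sub]
      · change a * (f (i + j)).toMul = a * (f i).toMul * (f j).toMul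
        simp [mul_assoc]
      · change (f (j - i)).toMul = a * (f i).toMul * (a * (f j).toMul)
        rw [mul_assoc, ← mul_assoc _ a, hf, mul_assoc, ← toMul_add, ← map_add, neg_add_eq_sub,
          ← mul_assoc, ha, one_mul] }

theorem DihedralGroup.liftHom_r_one {G : Type*} [Group G] {n : ℕ} {a c : G} (ha : a * a = 1)
    (hc : c ^ n = 1) (hac : a * c * a = c⁻¹) : liftHom n a c ha hc hac (r 1) = c := by
  change Additive.toMul (ZMod.lift (A := Additive G) n _ (1 : ZMod n)) = c
  rw [← Int.cast_one, ZMod.lift_coe]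
  simp

theorem DihedralGroup.liftHom_sr_zero {G : Type*} [Group G] {n : ℕ} {a c : G} (ha : a * a = 1)
    (hc : c ^ n = 1) (hac : a * c * a = c⁻¹) : liftHom n a c ha hc hac (sr 0) = a := by
  change a * Additive.toMul (ZMod.lift (A := Additive G) n _ (0 : ZMod n)) = a
  simp

/-- A homomorphism from the dihedral group of order eight is injective as soon as it does not kill
the central rotation. -/
theorem DihedralGroup.injective_of_map_r_two_ne_one {G : Type*} [Group G]
    (f : DihedralGroup 4 →* G) (hf : f (r 2) ≠ 1) : Function.Injective f := by
  have key : ∀ x : DihedralGroup 4,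
      x = 1 ∨ x = r 2 ∨ x * x = r 2 ∨ x * r 1 * x⁻¹ * (r 1)⁻¹ = r 2 := by decide
  refine (injective_iff_map_eq_one f).2 fun x hx => ?_
  rcases key x with h | h | h | h
  · exact h
  all_goals
    refine absurd ?_ hf
    rw [← h]
    simp [hx, -inv_r]

/-- If `a`, `b` are anticommuting involutive units of a ring in which `-1 ≠ 1`, then the subgroup
of units generated by `-1`, `a` and `b` is the dihedral group of order eight. -/
theorem nonempty_closure_mulEquiv_dihedralGroup_four {R : Type*} [Ring R] (h1 : (-1 : R) ≠ 1)
    (a b : Rˣ) (ha : a * a = 1) (hb : b * b = 1) (hab : a * b = -(b * a)) :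
    Nonempty (Subgroup.closure {-1, a, b} ≃* DihedralGroup 4) := by
  have hc2 : (a * b) ^ 2 = -1 := by
    rw [pow_two]
    nth_rw 1 [hab]
    rw [neg_mul, mul_assoc, ← mul_assoc a, ha, one_mul, hb]
  have hc4 : (a * b) ^ 4 = 1 := by
    rw [show 4 = 2 * 2 from rfl, pow_mul, hc2, neg_one_sq]
  have hac : a * (a * b) * a = (a * b)⁻¹ := by
    rw [← mul_assoc, ha, one_mul, mul_inv_rev, inv_eq_of_mul_eq_one_left ha,
      inv_eq_of_mul_eq_one_left hb]
  let f := DihedralGroup.liftHom 4 a (a * b) ha hc4 hac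
  have hr : f (.r 1) = a * b := DihedralGroup.liftHom_r_one ha hc4 hac
  have hs : f (.sr 0) = a := DihedralGroup.liftHom_sr_zero ha hc4 hac
  have hr2 : f (.r 2) = -1 := by
    rw [← hc2, ← hr, ← map_pow]
    rfl
  have hinj : Function.Injective f :=
    DihedralGroup.injective_of_map_r_two_ne_one f fun h =>
      h1 (by simpa using congrArg Units.val (hr2.symm.trans h))
  have hgen : ∀ x : DihedralGroup 4, ∃ i : ℕ, x = .r 1 ^ i ∨ x = .sr 0 * .r 1 ^ i := by
    rintro (i | i)
    · exact ⟨i.val, by simp⟩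
    · exact ⟨i.val, by simp⟩
  have hrange : f.range = Subgroup.closure {-1, a, b} := by
    apply le_antisymm
    · have hA : a ∈ Subgroup.closure {-1, a, b} := Subgroup.subset_closure (by simp)
      have hB : b ∈ Subgroup.closure {-1, a, b} := Subgroup.subset_closure (by simp)
      rintro _ ⟨x, rfl⟩
      obtain ⟨i, rfl | rfl⟩ := hgen x
      · rw [map_pow, hr]
        exact pow_mem (mul_mem hA hB) i
      · rw [map_mul, map_pow, hr, hs]
        exact mul_mem hA (pow_mem (mul_mem hA hB) i)
    · rw [Subgroup.closure_le]
      rintro _ (rfl | rfl | rfl)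
      · exact ⟨_, hr2⟩
      · exact ⟨_, hs⟩
      · exact ⟨.sr 0 * .r 1, by rw [map_mul, hs, hr, ← mul_assoc, ha, one_mul]⟩
  exact ⟨((MonoidHom.ofInjective hinj).trans (MulEquiv.subgroupCongr hrange)).symm⟩

theorem Qpq_two_zero_apply (v : Fin (2 + 0) → ℝ) : Qpq 2 0 v = v 0 * v 0 + v 1 * v 1 := by
  simp [Qpq, QuadraticMap.weightedSumSquares_apply, Fin.sum_univ_two]

theorem ι_single_mul_self (i : Fin (2 + 0)) :
    ι (Qpq 2 0) (Pi.single i 1) * ι (Qpq 2 0) (Pi.single i 1) = 1 := by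
  rw [ι_sq_scalar, Qpq_two_zero_apply]
  fin_cases i <;> simp

theorem ι_single_zero_mul_ι_single_one :
    ι (Qpq 2 0) (Pi.single 0 1) * ι (Qpq 2 0) (Pi.single 1 1) =
      -(ι (Qpq 2 0) (Pi.single 1 1) * ι (Qpq 2 0) (Pi.single 0 1)) := by
  apply ι_mul_ι_comm_of_isOrtho
  simp [QuadraticMap.isOrtho_def, Qpq_two_zero_apply]

theorem neg_one_ne_one_cliffordAlgebra_Qpq (p q : ℕ) : (-1 : CliffordAlgebra (Qpq p q)) ≠ 1 := by
  intro h
  have : Invertible (2 : ℝ) := invertibleOfNonzero two_ne_zero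
  have h2 : algebraMap ℝ (CliffordAlgebra (Qpq p q)) (-1) = algebraMap ℝ _ 1 := by simpa using h
  have := (algebraMap ℝ (CliffordAlgebra (Qpq p q))).injective h2
  norm_num at this

/-- The unit of `Cl_{2,0}` given by a standard basis vector. -/
noncomputable def unitι (i : Fin (2 + 0)) : (CliffordAlgebra (Qpq 2 0))ˣ where
  val := ι (Qpq 2 0) (Pi.single i 1)
  inv := ι (Qpq 2 0) (Pi.single i 1)
  val_inv := ι_single_mul_self i
  inv_val := ι_single_mul_self i

theorem Gpq_two_zero : Gpq 2 0 = Subgroup.closure {-1, unitι 0, unitι 1} := by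
  unfold Gpq
  congr 1
  ext u
  have h : (∃ i : Fin (2 + 0), (u : CliffordAlgebra (Qpq 2 0)) = ι (Qpq 2 0) (Pi.single i 1)) ↔
      u = unitι 0 ∨ u = unitι 1 := by
    rw [Units.ext_iff, Units.ext_iff]
    exact Fin.exists_fin_two
  have h' : (u : CliffordAlgebra (Qpq 2 0)) = -1 ↔ u = -1 := by
    rw [Units.ext_iff, Units.val_neg, Units.val_one]
  exact or_congr h' h

theorem stmt_10 : Nonempty (Gpq 2 0 ≃* DihedralGroup 4) := by
  rw [Gpq_two_zero]
  exact nonempty_closure_mulEquiv_dihedralGroup_four (neg_one_ne_one_cliffordAlgebra_Qpq 2 0) _ _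
    (Units.ext (ι_single_mul_self 0)) (Units.ext (ι_single_mul_self 1))
    (Units.ext ι_single_zero_mul_ι_single_one)
end

section
/- Let p, q be natural numbers with p + q odd and p − q ≡ 1 or 5 (mod 8) (so that the volume element ω satisfies ω² = 1 and is central). Then the real Clifford algebra Cl_{p,q} is isomorphic as an ℝ-algebra to the direct product of two copies of its even subalgebra: Cl_{p,q} ≃ₐ[ℝ] even(Q_{p,q}) × even(Q_{p,q}). -/
open CliffordAlgebra

section AnticommutingFamily

variable {R A : Type*} [CommRing R] [Ring A] [Algebra R A] {f : ℕ → A}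

/-- The ordered product of the first `n` terms of a sequence. -/
def orderedProd (f : ℕ → A) (n : ℕ) : A := ((List.range n).map f).prod

theorem orderedProd_zero (f : ℕ → A) : orderedProd f 0 = 1 := by
  simp [orderedProd]

theorem orderedProd_succ (f : ℕ → A) (n : ℕ) :
    orderedProd f (n + 1) = orderedProd f n * f n := by
  simp [orderedProd, List.range_succ]

theorem mul_orderedProd_of_le (hf : ∀ i j, i ≠ j → f i * f j = -(f j * f i)) {k n : ℕ}
    (hk : n ≤ k) : f k * orderedProd f n = (-1) ^ n * (orderedProd f n * f k) := by
  induction n with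
  | zero => simp [orderedProd_zero]
  | succ n ih =>
    rw [orderedProd_succ, ← mul_assoc, ih (by omega), mul_assoc, mul_assoc,
      hf k n (by omega), pow_succ]
    noncomm_ring

theorem mul_orderedProd_of_lt (hf : ∀ i j, i ≠ j → f i * f j = -(f j * f i)) {k n : ℕ}
    (hk : k < n) : f k * orderedProd f n = (-1) ^ (n + 1) * (orderedProd f n * f k) := by
  induction n with
  | zero => omega
  | succ n ih =>
    rcases Nat.lt_succ_iff_lt_or_eq.mp hk with h | rfl
    · rw [orderedProd_succ, ← mul_assoc, ih h, mul_assoc, mul_assoc, hf k n (by omega),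
        pow_succ _ (n + 1)]
      noncomm_ring
    · rw [orderedProd_succ, ← mul_assoc, mul_orderedProd_of_le hf le_rfl, pow_succ, pow_succ]
      noncomm_ring

theorem orderedProd_mul_self (hf : ∀ i j, i ≠ j → f i * f j = -(f j * f i)) {c : ℕ → R}
    (hc : ∀ i, f i * f i = algebraMap R A (c i)) (n : ℕ) :
    orderedProd f n * orderedProd f n =
      algebraMap R A (∏ i ∈ Finset.range n, (-1) ^ i * c i) := by
  induction n with
  | zero => simp [orderedProd_zero]
  | succ n ih =>
    rw [Finset.prod_range_succ, map_mul, ← ih, orderedProd_succ, mul_assoc,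
      ← mul_assoc (f n), mul_orderedProd_of_le hf le_rfl, map_mul, ← hc, map_pow, map_neg, map_one]
    rcases neg_one_pow_eq_or A n with h | h <;> rw [h] <;> noncomm_ring

end AnticommutingFamily

namespace CliffordAlgebra

variable {R M : Type*} [CommRing R] [AddCommGroup M] [Module R M] {Q : QuadraticForm R M}

theorem orderedProd_ι_mem_evenOdd (v : ℕ → M) (n : ℕ) :
    orderedProd (fun i => ι Q (v i)) n ∈ evenOdd Q n := by
  induction n with
  | zero =>
    rw [orderedProd_zero, Nat.cast_zero]
    exact (even Q).one_mem
  | succ n ih =>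
    rw [orderedProd_succ, Nat.cast_succ]
    exact SetLike.mul_mem_graded ih (ι_mem_evenOdd_one Q _)

theorem commute_of_commute_ι {w : CliffordAlgebra Q} (hw : ∀ v, Commute (ι Q v) w)
    (x : CliffordAlgebra Q) : Commute x w := by
  induction x using CliffordAlgebra.induction with
  | algebraMap r => exact Algebra.commutes r w
  | ι v => exact hw v
  | mul a b ha hb => exact ha.mul_left hb
  | add a b ha hb => exact ha.add_left hb

variable [Invertible (2 : R)]

/-- The homomorphism `(a, b) ↦ a (1 + w) / 2 + b (1 - w) / 2` attached to a central square root
`w` of `1`. -/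
def evenProdHom (w : CliffordAlgebra Q) (hw : ∀ x, Commute x w) (hsq : w * w = 1) :
    even Q × even Q →ₐ[R] CliffordAlgebra Q :=
  AlgHom.ofLinearMap
    { toFun := fun x => (⅟2 : R) • ((x.1 : CliffordAlgebra Q) * (1 + w) + x.2 * (1 - w))
      map_add' := fun x y => by
        simp only [← smul_add, Prod.fst_add, Prod.snd_add, Subalgebra.coe_add]
        congr 1
        noncomm_ring
      map_smul' := fun r x => by
        simp [smul_comm r (⅟2 : R)] }
    (by
      change (⅟2 : R) • ((1 : CliffordAlgebra Q) * (1 + w) + 1 * (1 - w)) = 1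
      rw [show (1 : CliffordAlgebra Q) * (1 + w) + 1 * (1 - w) = (2 : R) • 1 by
        rw [two_smul]; noncomm_ring, invOf_smul_smul])
    (fun x y => by
      obtain ⟨⟨a, _⟩, ⟨b, _⟩⟩ := x
      obtain ⟨⟨c, _⟩, ⟨d, _⟩⟩ := y
      change (⅟2 : R) • (a * c * (1 + w) + b * d * (1 - w)) =
        (⅟2 : R) • (a * (1 + w) + b * (1 - w)) * (⅟2 : R) • (c * (1 + w) + d * (1 - w))
      have h₁ : (1 + w) * (1 + w) = (2 : R) • (1 + w) := by
        rw [two_smul, mul_add, add_mul, add_mul, hsq]; noncomm_ring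
      have h₂ : (1 - w) * (1 - w) = (2 : R) • (1 - w) := by
        rw [two_smul, mul_sub, sub_mul, sub_mul, hsq]; noncomm_ring
      have h₃ : (1 + w) * (1 - w) = 0 := by
        rw [mul_sub, add_mul, add_mul, hsq]; noncomm_ring
      have h₄ : (1 - w) * (1 + w) = 0 := by
        rw [mul_add, sub_mul, sub_mul, hsq]; noncomm_ring
      have hp (z : CliffordAlgebra Q) : (1 + w) * z = z * (1 + w) :=
        ((Commute.one_right z).add_right (hw z)).symm
      have hm (z : CliffordAlgebra Q) : (1 - w) * z = z * (1 - w) :=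
        ((Commute.one_right z).sub_right (hw z)).symm
      have key : (a * (1 + w) + b * (1 - w)) * (c * (1 + w) + d * (1 - w)) =
          (2 : R) • (a * c * (1 + w) + b * d * (1 - w)) := by
        have e (s t u z : CliffordAlgebra Q) (h : t * u = u * t) :
            s * t * (u * z) = s * u * (t * z) := by
          rw [mul_assoc, ← mul_assoc t, h]; noncomm_ring
        rw [add_mul (a * (1 + w)), mul_add (a * (1 + w)), mul_add (b * (1 - w)), e _ _ _ _ (hp c), e _ _ _ _ (hp d), e _ _ _ _ (hm c),
          e _ _ _ _ (hm d), h₁, h₂, h₃, h₄, mul_smul_comm, mul_smul_comm, mul_zero, mul_zero,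
          add_zero, zero_add, smul_add]
      rw [smul_mul_smul_comm, key, smul_smul, mul_assoc (⅟2 : R), invOf_mul_self, mul_one])

theorem evenProdHom_apply (w : CliffordAlgebra Q) (hw : ∀ x, Commute x w) (hsq : w * w = 1)
    (x : even Q × even Q) :
    evenProdHom w hw hsq x =
      (⅟2 : R) • ((x.1 : CliffordAlgebra Q) * (1 + w) + x.2 * (1 - w)) :=
  rfl

theorem evenProdHom_bijective (w : CliffordAlgebra Q) (hw : ∀ x, Commute x w) (hsq : w * w = 1)
    (hodd : w ∈ evenOdd Q 1) : Function.Bijective (evenProdHom w hw hsq) := by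
  constructor
  · rw [injective_iff_map_eq_zero]
    rintro ⟨⟨a, ha⟩, ⟨b, hb⟩⟩ h
    rw [evenProdHom_apply] at h
    have h0 : a * (1 + w) + b * (1 - w) = 0 := by
      rw [← smul_invOf_smul (2 : R) (a * (1 + w) + b * (1 - w))]
      exact (congrArg ((2 : R) • ·) h).trans (smul_zero _)
    have hab : (a - b) * w = -(a + b) := by
      rw [eq_neg_iff_add_eq_zero, ← h0]; noncomm_ring
    have hplus : a + b = 0 := by
      refine Submodule.disjoint_def.mp (evenOdd_isCompl Q).disjoint _ ((even Q).add_mem ha hb) ?_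
      rw [← neg_neg (a + b), ← hab]
      have := SetLike.mul_mem_graded ((even Q).sub_mem ha hb : a - b ∈ evenOdd Q 0) hodd
      rw [zero_add] at this
      exact Submodule.neg_mem _ this
    have hminus : a - b = 0 := by
      rw [← mul_one (a - b), ← hsq, ← mul_assoc, hab, hplus, neg_zero, zero_mul]
    have ha0 : a = 0 := by
      rw [← invOf_smul_smul (2 : R) a, two_smul,
        show a + a = (a + b) + (a - b) by abel, hplus, hminus, add_zero, smul_zero]
    have hb0 : b = 0 := by rwa [ha0, zero_add] at hplus
    subst ha0 hb0
    rfl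
  · intro x
    obtain ⟨y, hy, z, hz, rfl⟩ := Submodule.mem_sup.mp
      ((evenOdd_isCompl Q).sup_eq_top ▸ Submodule.mem_top : x ∈ evenOdd Q 0 ⊔ evenOdd Q 1)
    have hzw : z * w ∈ evenOdd Q 0 := by
      have := SetLike.mul_mem_graded hz hodd
      rwa [show (1 : ZMod 2) + 1 = 0 from rfl] at this
    refine ⟨(⟨y + z * w, (even Q).add_mem hy hzw⟩, ⟨y - z * w, (even Q).sub_mem hy hzw⟩), ?_⟩
    rw [evenProdHom_apply]
    have : (y + z * w) * (1 + w) + (y - z * w) * (1 - w) = (2 : R) • (y + z) := by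
      have hz' : z * w * w = z := by rw [mul_assoc, hsq, mul_one]
      rw [two_smul]
      simp only [mul_add, mul_sub, add_mul, sub_mul, mul_one, hz']
      abel
    rw [← invOf_smul_smul (2 : R) (y + z), ← this]

/-- A central odd square root of `1` splits the Clifford algebra into two copies of its even
subalgebra. -/
noncomputable def equivEvenProd (w : CliffordAlgebra Q) (hw : ∀ x, Commute x w)
    (hsq : w * w = 1) (hodd : w ∈ evenOdd Q 1) : CliffordAlgebra Q ≃ₐ[R] even Q × even Q :=
  (AlgEquiv.ofBijective _ (evenProdHom_bijective w hw hsq hodd)).symm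

end CliffordAlgebra

/-- The standard basis vectors of `ℝⁿ`, extended by zero to all natural indices. -/
noncomputable def stdVec (n i : ℕ) : Fin n → ℝ := fun j => if (j : ℕ) = i then 1 else 0

/-- The values of `Qpq p q` on the vectors `stdVec (p + q) i`. -/
noncomputable def signCoeff (p q i : ℕ) : ℝ :=
  if i < p + q then (if i < p then 1 else -1) else 0

theorem Qpq_stdVec (p q i : ℕ) : Qpq p q (stdVec (p + q) i) = signCoeff p q i := by
  simp only [Qpq, QuadraticMap.weightedSumSquares_apply, stdVec, signCoeff]
  split_ifs with h
  all_goals first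
    | rw [Finset.sum_eq_single (⟨i, h⟩ : Fin (p + q))]
      · simp [*]
      · intro b _ hb
        simp [show (b : ℕ) ≠ i from fun hbi => hb (Fin.ext hbi)]
      · simp
    | exact Finset.sum_eq_zero fun b _ => by simp [show (b : ℕ) ≠ i by omega]

theorem isOrtho_stdVec (p q : ℕ) {i j : ℕ} (hij : i ≠ j) :
    (Qpq p q).IsOrtho (stdVec (p + q) i) (stdVec (p + q) j) := by
  simp only [QuadraticMap.isOrtho_def, Qpq, QuadraticMap.weightedSumSquares_apply, stdVec,
    Pi.add_apply, ← Finset.sum_add_distrib]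
  refine Finset.sum_congr rfl fun b _ => ?_
  by_cases hi : (b : ℕ) = i
  · simp [hi, hij]
  · simp [hi]

theorem sum_smul_stdVec {n : ℕ} (v : Fin n → ℝ) : ∑ i : Fin n, v i • stdVec n i = v := by
  ext j
  simp [stdVec, Fin.val_inj]

theorem prod_signCoeff (p q : ℕ) : ∏ i ∈ Finset.range (p + q), signCoeff p q i = (-1) ^ q := by
  rw [Finset.prod_range_add, Finset.prod_congr rfl (g := fun _ => (1 : ℝ)),
    Finset.prod_congr (s₁ := Finset.range q) rfl (g := fun _ => (-1 : ℝ))]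
  · simp
  · intro i hi
    simp [signCoeff, Finset.mem_range.mp hi]
  · intro i hi
    have := Finset.mem_range.mp hi
    simp [signCoeff, this, show i < p + q by omega]

theorem prod_neg_one_pow_mul_signCoeff {p q : ℕ} (hsig : ((p : ℤ) - q) % 4 = 1) :
    ∏ i ∈ Finset.range (p + q), (-1) ^ i * signCoeff p q i = 1 := by
  rw [Finset.prod_mul_distrib, Finset.prod_pow_eq_pow_sum, prod_signCoeff, ← pow_add]
  apply Even.neg_one_pow
  obtain ⟨m, hm⟩ : ∃ m, p + q = 2 * m + 1 := ⟨(p + q) / 2, by omega⟩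
  have hsum := Finset.sum_range_id_mul_two (p + q)
  have hS : ∑ i ∈ Finset.range (p + q), i = 2 * (m * m) + m := by
    rw [hm, Nat.add_sub_cancel] at hsum
    rw [hm]
    nlinarith
  rw [hS, Nat.even_iff]
  omega

theorem stmt_12 (p q : ℕ) (hodd : Odd (p + q))
    (hsig : ((p : ℤ) - q) % 8 = 1 ∨ ((p : ℤ) - q) % 8 = 5) :
    Nonempty (CliffordAlgebra (Qpq p q) ≃ₐ[ℝ]
      (even (Qpq p q) × even (Qpq p q))) := by
  let e : ℕ → CliffordAlgebra (Qpq p q) := fun i => ι (Qpq p q) (stdVec (p + q) i)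
  have he (i j : ℕ) (hij : i ≠ j) : e i * e j = -(e j * e i) :=
    ι_mul_ι_comm_of_isOrtho (isOrtho_stdVec p q hij)
  have hsq (i : ℕ) : e i * e i = algebraMap ℝ _ (signCoeff p q i) := by
    rw [← Qpq_stdVec]
    exact ι_sq_scalar _ _
  refine ⟨equivEvenProd (orderedProd e (p + q)) (commute_of_commute_ι fun v => ?_) ?_ ?_⟩
  · rw [← sum_smul_stdVec v, map_sum]
    refine Commute.sum_left _ _ _ fun i _ => ?_
    rw [map_smul]
    refine Commute.smul_left ?_ _
    have := mul_orderedProd_of_lt he i.isLt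
    rwa [hodd.add_one.neg_one_pow, one_mul] at this
  · rw [orderedProd_mul_self he hsq, prod_neg_one_pow_mul_signCoeff (by omega), map_one]
  · rw [← (ZMod.natCast_eq_one_iff_odd.mpr hodd : ((p + q : ℕ) : ZMod 2) = 1)]
    exact orderedProd_ι_mem_evenOdd _ _
end

section
/- Let n be an odd natural number and let Q be the diagonal quadratic form on ℂ^n (Lean: Fin n → ℂ) with all coefficients equal to 1. Then the complex Clifford algebra CliffordAlgebra Q is isomorphic as a ℂ-algebra to the direct product of two copies of its even subalgebra: CliffordAlgebra Q ≃ₐ[ℂ] even(Q) × even(Q). -/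
open CliffordAlgebra

/-- The sum-of-squares quadratic form on `ℂ^n`. -/
noncomputable def Qc (n : ℕ) : QuadraticForm ℂ (Fin n → ℂ) :=
  QuadraticMap.weightedSumSquares ℂ (fun _ : Fin n => (1 : ℂ))

section AnticommutingFamily

variable {A κ : Type*} [Ring A] {e : κ → A}

theorem list_prod_mul_of_notMem (he : ∀ i j, i ≠ j → e i * e j = -(e j * e i)) (i : κ)
    (l : List κ) (hi : i ∉ l) :
    (l.map e).prod * e i = (-1) ^ l.length * (e i * (l.map e).prod) := by
  induction l with
  | nil => simp
  | cons j t ih =>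
    rw [List.mem_cons, not_or] at hi
    have hc := ((Commute.neg_one_left (e j)).pow_left t.length).eq
    rw [List.map_cons, List.prod_cons, mul_assoc, ih hi.2, ← mul_assoc, ← hc, mul_assoc,
      ← mul_assoc (e j), he j i (Ne.symm hi.1), List.length_cons, pow_succ]
    simp [mul_assoc]

theorem list_prod_mul_of_mem (he : ∀ i j, i ≠ j → e i * e j = -(e j * e i)) (i : κ)
    (l : List κ) (hl : l.Nodup) (hi : i ∈ l) :
    (l.map e).prod * e i = -((-1) ^ l.length * (e i * (l.map e).prod)) := by
  induction l with
  | nil => simp at hi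
  | cons j t ih =>
    rw [List.nodup_cons] at hl
    have hc := ((Commute.neg_one_left (e j)).pow_left t.length).eq
    rcases eq_or_ne i j with rfl | hij
    · rw [List.map_cons, List.prod_cons, mul_assoc, list_prod_mul_of_notMem he i t hl.1,
        ← mul_assoc, ← hc, List.length_cons, pow_succ]
      simp [mul_assoc]
    · rw [List.map_cons, List.prod_cons, mul_assoc,
        ih hl.2 ((List.mem_cons.mp hi).resolve_left hij), mul_neg, ← mul_assoc, ← hc, mul_assoc,
        ← mul_assoc (e j), he j i hij.symm, List.length_cons, pow_succ]
      simp [mul_assoc]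

theorem list_prod_mul_self (he : ∀ i j, i ≠ j → e i * e j = -(e j * e i))
    (hsq : ∀ i, e i * e i = 1) (l : List κ) (hl : l.Nodup) :
    (l.map e).prod * (l.map e).prod = 1 ∨ (l.map e).prod * (l.map e).prod = -1 := by
  induction l with
  | nil => simp
  | cons j t ih =>
    rw [List.nodup_cons] at hl
    have hc := ((Commute.neg_one_left (e j)).pow_left t.length).eq
    have key : ((j :: t).map e).prod * ((j :: t).map e).prod =
        (-1) ^ t.length * ((t.map e).prod * (t.map e).prod) := by
      rw [List.map_cons, List.prod_cons, mul_assoc, ← mul_assoc (t.map e).prod,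
        list_prod_mul_of_notMem he j t hl.1, ← mul_assoc, ← mul_assoc, ← hc, mul_assoc, mul_assoc,
        mul_assoc, ← mul_assoc (e j), hsq, one_mul]
    rw [key]
    rcases neg_one_pow_eq_or A t.length with h | h <;> rcases ih hl.2 with h' | h' <;>
      simp [h, h']

end AnticommutingFamily

namespace CliffordAlgebra

section CentralOddInvolution

variable {R M : Type*} [CommRing R] [AddCommGroup M] [Module R M] {Q : QuadraticForm R M}

theorem list_prod_map_ι_mem_evenOdd (l : List M) :
    (l.map (ι Q)).prod ∈ evenOdd Q (l.length : ZMod 2) := by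
  induction l with
  | nil => simpa using SetLike.GradedOne.one_mem (A := evenOdd Q)
  | cons m t ih =>
    rw [List.map_cons, List.prod_cons, List.length_cons, Nat.cast_succ, add_comm]
    exact SetLike.mul_mem_graded (ι_mem_evenOdd_one Q m) ih

variable [Invertible (2 : R)]

/-- A central element `z` with `z * z = 1` yields two complementary idempotents `(1 ± z) / 2`,
which combine two copies of the even subalgebra. -/
def evenProdEvenHom (z : CliffordAlgebra Q) (hc : ∀ x, z * x = x * z) (hz : z * z = 1) :
    (even Q × even Q) →ₐ[R] CliffordAlgebra Q :=
  AlgHom.ofLinearMap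
    { toFun := fun p => ⅟(2 : R) • ((p.1 : CliffordAlgebra Q) * (1 + z) + p.2 * (1 - z))
      map_add' := fun p q => by
        simp only [Prod.fst_add, Prod.snd_add, Subalgebra.coe_add, add_mul, ← smul_add]
        congr 1
        abel
      map_smul' := fun r p => by
        simp only [Prod.smul_fst, Prod.smul_snd, Subalgebra.coe_smul, smul_mul_assoc, ← smul_add,
          RingHom.id_apply]
        rw [smul_comm] }
    (by
      have : (1 + z) + (1 - z) = (2 : R) • (1 : CliffordAlgebra Q) := by
        rw [two_smul]; abel
      simp only [LinearMap.coe_mk, AddHom.coe_mk, Prod.fst_one, Prod.snd_one, Subalgebra.coe_one,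
        one_mul, this, smul_smul, invOf_mul_self, one_smul])
    (by
      rintro ⟨a, b⟩ ⟨c, d⟩
      have hp : (1 + z) * (1 + z) = (2 : R) • (1 + z) := by
        rw [two_smul]; simp only [mul_add, add_mul, hz, one_mul, mul_one]; abel
      have hm : (1 - z) * (1 - z) = (2 : R) • (1 - z) := by
        rw [two_smul]; simp only [mul_sub, sub_mul, hz, one_mul, mul_one]; abel
      have hpm : (1 + z) * (1 - z) = 0 := by
        simp only [mul_sub, add_mul, hz, one_mul, mul_one]; abel
      have hmp : (1 - z) * (1 + z) = 0 := by
        simp only [mul_add, sub_mul, hz, one_mul, mul_one]; abel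
      have cp : ∀ x, (1 + z) * x = x * (1 + z) := fun x => by simp [mul_add, add_mul, hc x]
      have cm : ∀ x, (1 - z) * x = x * (1 - z) := fun x => by simp [mul_sub, sub_mul, hc x]
      have swap : ∀ (x y u v : CliffordAlgebra Q), u * y = y * u →
          x * u * (y * v) = x * y * (u * v) := fun x y u v h => by
        rw [mul_assoc, ← mul_assoc u, h, mul_assoc y, ← mul_assoc x]
      simp only [LinearMap.coe_mk, AddHom.coe_mk, Prod.mk_mul_mk, Subalgebra.coe_mul,
        smul_mul_smul_comm, add_mul, mul_add (_ * _ : CliffordAlgebra Q) (_ * _) (_ * _)]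
      rw [swap _ _ _ _ (cp _), swap _ _ _ _ (cp _), swap _ _ _ _ (cm _), swap _ _ _ _ (cm _),
        hp, hm, hpm, hmp]
      simp only [mul_zero, add_zero, zero_add, mul_smul_comm, ← smul_add, smul_smul]
      simp [mul_assoc])

theorem evenProdEvenHom_apply (z : CliffordAlgebra Q) (hc : ∀ x, z * x = x * z) (hz : z * z = 1)
    (p : even Q × even Q) :
    evenProdEvenHom z hc hz p =
      ⅟(2 : R) • ((p.1 : CliffordAlgebra Q) * (1 + z) + p.2 * (1 - z)) :=
  rfl

theorem evenProdEvenHom_bijective (z : CliffordAlgebra Q) (hc : ∀ x, z * x = x * z)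
    (hz : z * z = 1) (hodd : z ∈ evenOdd Q 1) :
    Function.Bijective (evenProdEvenHom z hc hz) := by
  have half : ∀ x : CliffordAlgebra Q, ⅟(2 : R) • (x + x) = x := fun x => by
    rw [← two_smul R x, smul_smul, invOf_mul_self, one_smul]
  constructor
  · rw [injective_iff_map_eq_zero]
    rintro ⟨⟨a, ha⟩, ⟨b, hb⟩⟩ h
    rw [evenProdEvenHom_apply] at h
    change a ∈ evenOdd Q 0 at ha
    change b ∈ evenOdd Q 0 at hb
    have h0 : (a + b) + (a - b) * z = 0 := by
      have := congrArg (fun x => (2 : R) • x) h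
      simp only [smul_smul, mul_invOf_self, one_smul, smul_zero] at this
      rw [← this]
      simp only [mul_add, mul_sub, sub_mul, mul_one]
      abel
    have hmem : (a - b) * z ∈ evenOdd Q 1 := by
      simpa using SetLike.mul_mem_graded (sub_mem ha hb) hodd
    have hsum : a + b = 0 := by
      refine (Submodule.disjoint_def.mp (evenOdd_isCompl Q).disjoint) _ (add_mem ha hb) ?_
      rw [eq_neg_of_add_eq_zero_left h0]
      exact neg_mem hmem
    have hdiff : a - b = 0 := by
      rw [hsum, zero_add] at h0
      rw [← mul_one (a - b), ← hz, ← mul_assoc, h0, zero_mul]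
    have ha0 : a = 0 := by
      rw [← half a]
      nth_rw 2 [sub_eq_zero.mp hdiff]
      rw [hsum, smul_zero]
    have hb0 : b = 0 := by rw [← sub_eq_zero.mp hdiff, ha0]
    subst ha0 hb0
    rfl
  · intro x
    have hx : x ∈ evenOdd Q 0 ⊔ evenOdd Q 1 := by
      rw [(evenOdd_isCompl Q).sup_eq_top]
      exact Submodule.mem_top
    obtain ⟨u, hu, v, hv, rfl⟩ := Submodule.mem_sup.mp hx
    have hvz : v * z ∈ evenOdd Q 0 := by
      have := SetLike.mul_mem_graded hv hodd
      rwa [show (1 + 1 : ZMod 2) = 0 from rfl] at this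
    refine ⟨⟨⟨u + v * z, add_mem hu hvz⟩, ⟨u - v * z, sub_mem hu hvz⟩⟩, ?_⟩
    rw [evenProdEvenHom_apply, ← half (u + v)]
    congr 1
    simp only [mul_add, mul_sub, add_mul, sub_mul, mul_one, mul_assoc, hz]
    abel

end CentralOddInvolution

theorem exists_central_odd_involution (n : ℕ) (hodd : Odd n) :
    ∃ z : CliffordAlgebra (Qc n), (∀ x, z * x = x * z) ∧ z * z = 1 ∧ z ∈ evenOdd (Qc n) 1 := by
  let b : Fin n → Fin n → ℂ := fun i => Pi.single i 1
  let e : Fin n → CliffordAlgebra (Qc n) := fun i => ι (Qc n) (b i)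
  have hQ : ∀ v, Qc n v = ∑ i, v i * v i := fun v => by
    simp [Qc, QuadraticMap.weightedSumSquares_apply]
  have hsq : ∀ i, e i * e i = 1 := fun i => by
    have : Qc n (b i) = 1 := by simp [hQ, b, Pi.single_apply]
    simp only [e, ι_sq_scalar, this, map_one]
  have he : ∀ i j, i ≠ j → e i * e j = -(e j * e i) := fun i j hij => by
    refine ι_mul_ι_comm_of_isOrtho ?_
    rw [QuadraticMap.isOrtho_def]
    simp only [hQ, b, Pi.add_apply, ← Finset.sum_add_distrib]
    refine Finset.sum_congr rfl fun k _ => ?_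
    have : (Pi.single i 1 : Fin n → ℂ) k * (Pi.single j 1 : Fin n → ℂ) k = 0 := by
      rcases eq_or_ne k i with rfl | hk
      · simp [hij]
      · simp [hk]
    linear_combination 2 * this
  let w := ((List.finRange n).map e).prod
  have hwe : ∀ i, w * e i = e i * w := fun i => by
    have := list_prod_mul_of_mem he i _ (List.nodup_finRange n) (List.mem_finRange i)
    rwa [List.length_finRange, hodd.neg_one_pow, neg_one_mul, neg_neg] at this
  have hcent : ∀ x, w * x = x * w := fun x => by
    induction x using CliffordAlgebra.induction with
    | algebraMap r => exact (Algebra.commutes r w).symm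
    | ι m =>
      have : ι (Qc n) m = ∑ i, m i • e i := by
        rw [LinearMap.pi_apply_eq_sum_univ (ι (Qc n)) m]
        refine Finset.sum_congr rfl fun i _ => ?_
        congr 2
        funext j
        simp [b, Pi.single_apply, eq_comm]
      simp [this, Finset.mul_sum, Finset.sum_mul, hwe]
    | mul x y hx hy => rw [← mul_assoc, hx, mul_assoc, hy, mul_assoc]
    | add x y hx hy => rw [mul_add, add_mul, hx, hy]
  have hw : w ∈ evenOdd (Qc n) 1 := by
    have := list_prod_map_ι_mem_evenOdd (Q := Qc n) ((List.finRange n).map b)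
    rwa [List.length_map, List.length_finRange, (ZMod.natCast_eq_one_iff_odd).mpr hodd,
      List.map_map] at this
  rcases list_prod_mul_self he hsq _ (List.nodup_finRange n) with h | h
  · exact ⟨w, hcent, h, hw⟩
  · refine ⟨Complex.I • w, fun x => ?_, ?_, Submodule.smul_mem _ _ hw⟩
    · rw [smul_mul_assoc, hcent, mul_smul_comm]
    · rw [smul_mul_smul_comm, Complex.I_mul_I, show w * w = -1 from h, neg_one_smul, neg_neg]

end CliffordAlgebra

theorem stmt_13 (n : ℕ) (hodd : Odd n) :
    Nonempty (CliffordAlgebra (Qc n) ≃ₐ[ℂ] (even (Qc n) × even (Qc n))) := by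
  obtain ⟨z, hc, hz, hz1⟩ := exists_central_odd_involution n hodd
  exact ⟨(AlgEquiv.ofBijective _ (evenProdEvenHom_bijective z hc hz hz1)).symm⟩
end

section
/- Let p, q be natural numbers with p + q odd and p − q ≡ 3 or 7 (mod 8) (so that the volume element ω is central with ω² = −1). Then the center of Cl_{p,q}, namely the ℝ-subalgebra generated by ω, is isomorphic as an ℝ-algebra to ℂ. -/
open CliffordAlgebra

section Anticommuting

variable {K A I : Type*} [Field K] [Ring A] [Algebra K A] {e : I → A} {w : I → K}

theorem List.Perm.exists_prod_map_eq_smul (hanti : ∀ i j, i ≠ j → e i * e j = -(e j * e i))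
    {l l' : List I} (h : l.Perm l') : ∃ c : K, (l.map e).prod = c • (l'.map e).prod := by
  induction h with
  | nil => exact ⟨1, by simp⟩
  | cons a _ ih =>
    obtain ⟨c, hc⟩ := ih
    exact ⟨c, by simp [hc]⟩
  | swap a b t =>
    rcases eq_or_ne a b with rfl | h
    · exact ⟨1, by simp⟩
    · exact ⟨-1, by simp [← mul_assoc, hanti b a h.symm]⟩
  | trans _ _ ih₁ ih₂ =>
    obtain ⟨c, hc⟩ := ih₁
    obtain ⟨d, hd⟩ := ih₂
    exact ⟨c * d, by rw [hc, hd, smul_smul]⟩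

theorem span_range_prod_map_eq_top (htop : Algebra.adjoin K (Set.range e) = ⊤) :
    Submodule.span K (Set.range fun l : List I => (l.map e).prod) = ⊤ := by
  rw [← Algebra.top_toSubmodule, ← htop, Algebra.adjoin_eq_span]
  congr 1
  ext x
  constructor
  · rintro ⟨l, rfl⟩
    exact list_prod_mem fun y hy => by
      obtain ⟨i, -, rfl⟩ := List.mem_map.1 hy
      exact Submonoid.subset_closure ⟨i, rfl⟩
  · intro hx
    induction hx using Submonoid.closure_induction with
    | mem x hx =>
      obtain ⟨i, rfl⟩ := hx
      exact ⟨[i], by simp⟩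
    | one => exact ⟨[], by simp⟩
    | mul x y _ _ hx hy =>
      obtain ⟨l, rfl⟩ := hx
      obtain ⟨l', rfl⟩ := hy
      exact ⟨l ++ l', by simp⟩

variable [DecidableEq I]

theorem mul_prod_map_of_anticommute (hanti : ∀ i j, i ≠ j → e i * e j = -(e j * e i))
    (i : I) (l : List I) :
    e i * (l.map e).prod = (-1 : K) ^ (l.length + l.count i) • ((l.map e).prod * e i) := by
  induction l with
  | nil => simp
  | cons a t ih =>
    rw [List.map_cons, List.prod_cons]
    rcases eq_or_ne a i with rfl | h
    · rw [mul_assoc (e a) _ (e a), ← mul_smul_comm, List.length_cons, List.count_cons_self,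
        show t.length + 1 + (t.count a + 1) = t.length + t.count a + 2 by ring, pow_add,
        neg_one_sq, mul_one, ← ih]
    · rw [← mul_assoc, hanti i a h.symm, neg_mul, mul_assoc, ih, List.length_cons,
        List.count_cons_of_ne h, add_right_comm, pow_succ, mul_neg_one, neg_smul, mul_smul_comm,
        mul_assoc]

theorem exists_prod_map_eq_smul_one_of_even_count
    (hanti : ∀ i j, i ≠ j → e i * e j = -(e j * e i)) (hsq : ∀ i, e i * e i = algebraMap K A (w i))
    (l : List I) (hl : ∀ i, Even (l.count i)) : ∃ c : K, (l.map e).prod = c • (1 : A) := by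
  match l with
  | [] => exact ⟨1, by simp⟩
  | a :: t =>
    have ha : a ∈ t := by
      have := hl a
      rw [List.count_cons_self] at this
      rw [← List.count_pos_iff]
      grind
    have hperm : (a :: t).Perm (a :: a :: t.erase a) := (List.perm_cons_erase ha).cons a
    obtain ⟨c, hc⟩ := exists_prod_map_eq_smul_one_of_even_count hanti hsq (t.erase a) fun i => by
      have := hl i
      rw [hperm.count_eq] at this
      simp only [List.count_cons] at this
      grind
    obtain ⟨d, hd⟩ := hperm.exists_prod_map_eq_smul (K := K) hanti
    refine ⟨d * (w a * c), ?_⟩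
    rw [hd, List.map_cons, List.map_cons, List.prod_cons, List.prod_cons, ← mul_assoc, hsq,
      ← Algebra.smul_def, hc, smul_smul, smul_smul, mul_assoc]
termination_by l.length
decreasing_by grind

theorem prod_map_mem_span_of_even_length_add_count
    (hanti : ∀ i j, i ≠ j → e i * e j = -(e j * e i)) (hsq : ∀ i, e i * e i = algebraMap K A (w i))
    {L : List I} (hnodup : L.Nodup) (hmem : ∀ i, i ∈ L) {l : List I}
    (hl : ∀ i, Even (l.length + l.count i)) :
    (l.map e).prod ∈ Submodule.span K {1, (L.map e).prod} := by
  rcases Nat.even_or_odd l.length with h | h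
  · obtain ⟨c, hc⟩ := exists_prod_map_eq_smul_one_of_even_count hanti hsq l fun i => by
      have := hl i
      grind
    rw [hc]
    exact Submodule.smul_mem _ _ (Submodule.subset_span (by simp))
  · have hodd : ∀ i, Odd (l.count i) := fun i => by
      have := hl i
      grind
    have hcount : ∀ i ∈ L, L.count i ≤ l.count i := fun i hi => by
      rw [List.count_eq_one_of_mem hnodup hi]
      exact (hodd i).pos
    have ht := (List.subperm_append_diff_self_of_count_le hcount).symm
    obtain ⟨c, hc⟩ := exists_prod_map_eq_smul_one_of_even_count hanti hsq (l.diff L) fun i => by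
      have := hodd i
      rw [ht.count_eq, List.count_append, List.count_eq_one_of_mem hnodup (hmem i)] at this
      grind
    obtain ⟨d, hd⟩ := ht.exists_prod_map_eq_smul (K := K) hanti
    rw [hd, List.map_append, List.prod_append, hc, mul_smul_comm, mul_one]
    exact Submodule.smul_mem _ _ (Submodule.smul_mem _ _ (Submodule.subset_span (by simp)))

theorem prod_map_mul_self_of_nodup (hanti : ∀ i j, i ≠ j → e i * e j = -(e j * e i))
    (hsq : ∀ i, e i * e i = algebraMap K A (w i)) {l : List I} (hl : l.Nodup) :
    (l.map e).prod * (l.map e).prod =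
      algebraMap K A ((-1) ^ l.length.choose 2 * (l.map w).prod) := by
  induction l with
  | nil => simp
  | cons a t ih =>
    rw [List.nodup_cons] at hl
    have hcomm := mul_prod_map_of_anticommute (K := K) hanti a t
    rw [List.count_eq_zero_of_not_mem hl.1, add_zero] at hcomm
    have hcomm' : (t.map e).prod * e a = (-1 : K) ^ t.length • (e a * (t.map e).prod) := by
      rw [hcomm, smul_smul, ← mul_pow]
      simp
    rw [List.map_cons, List.prod_cons, mul_assoc, ← mul_assoc _ (e a), hcomm', smul_mul_assoc,
      mul_smul_comm, mul_assoc (e a), ← mul_assoc (e a), hsq, ih hl.2, Algebra.smul_def,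
      ← map_mul, ← map_mul, List.length_cons, Nat.choose_succ_succ' t.length 1, Nat.choose_one_right,
      List.map_cons, List.prod_cons]
    congr 1
    ring

theorem mem_span_prod_map_of_forall_commute [NeZero (2 : K)]
    (hanti : ∀ i j, i ≠ j → e i * e j = -(e j * e i)) (hsq : ∀ i, e i * e i = algebraMap K A (w i))
    (hw : ∀ i, w i ≠ 0) (htop : Algebra.adjoin K (Set.range e) = ⊤) {x : A}
    (hx : ∀ i, Commute (e i) x) (T : Finset I) :
    x ∈ Submodule.span K
      ((fun l : List I => (l.map e).prod) '' {l | ∀ i ∈ T, Even (l.length + l.count i)}) := by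
  induction T using Finset.induction_on with
  | empty => simp [span_range_prod_map_eq_top htop]
  | insert i T _ ih =>
    let P : A →ₗ[K] A := (2⁻¹ : K) • (LinearMap.id +
      (w i)⁻¹ • (LinearMap.mulLeft K (e i) ∘ₗ LinearMap.mulRight K (e i)))
    have hP (y : A) : P y = (2⁻¹ : K) • (y + (w i)⁻¹ • (e i * (y * e i))) := rfl
    have hmul (y : A) (c : K) (hy : e i * y = c • (y * e i)) :
        P y = (2⁻¹ * (1 + c)) • y := by
      rw [hP, ← mul_assoc, hy, smul_mul_assoc, mul_assoc, hsq, ← Algebra.commutes,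
        ← Algebra.smul_def, smul_comm c, smul_smul (w i)⁻¹, inv_mul_cancel₀ (hw i), one_smul,
        mul_smul, add_smul, one_smul]
    have hPx : P x = x := by
      rw [hmul x 1 (by rw [one_smul]; exact hx i), one_add_one_eq_two,
        inv_mul_cancel₀ (NeZero.ne 2), one_smul]
    rw [← hPx]
    refine Submodule.mem_comap.1 (Submodule.span_le.2 ?_ ih)
    rintro _ ⟨l, hl, rfl⟩
    simp only [Submodule.comap_coe, Set.mem_preimage, SetLike.mem_coe]
    rw [hmul _ _ (mul_prod_map_of_anticommute hanti i l)]
    rcases Nat.even_or_odd (l.length + l.count i) with h | h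
    · refine Submodule.smul_mem _ _ (Submodule.subset_span ⟨l, ?_, rfl⟩)
      simpa [h] using hl
    · simp [h.neg_one_pow]

theorem center_eq_adjoin_prod_map [NeZero (2 : K)]
    (hanti : ∀ i j, i ≠ j → e i * e j = -(e j * e i)) (hsq : ∀ i, e i * e i = algebraMap K A (w i))
    (hw : ∀ i, w i ≠ 0) (htop : Algebra.adjoin K (Set.range e) = ⊤)
    {L : List I} (hnodup : L.Nodup) (hmem : ∀ i, i ∈ L) (hodd : Odd L.length) :
    Subalgebra.center K A = Algebra.adjoin K {(L.map e).prod} := by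
  apply le_antisymm
  · intro x hx
    have hspan := mem_span_prod_map_of_forall_commute hanti hsq hw htop
      (fun i => Subalgebra.mem_center_iff.1 hx (e i)) L.toFinset
    have hle : Submodule.span K {1, (L.map e).prod} ≤
        Subalgebra.toSubmodule (Algebra.adjoin K {(L.map e).prod}) := by
      rw [Submodule.span_le, Set.insert_subset_iff, Set.singleton_subset_iff]
      exact ⟨one_mem (Algebra.adjoin K _), Algebra.subset_adjoin rfl⟩
    refine hle (Submodule.span_le.2 ?_ hspan)
    rintro _ ⟨l, hl, rfl⟩
    exact prod_map_mem_span_of_even_length_add_count hanti hsq hnodup hmem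
      fun i => hl i (List.mem_toFinset.2 (hmem i))
  · refine Algebra.adjoin_le (Set.singleton_subset_iff.2 (Subalgebra.mem_center_iff.2 fun y => ?_))
    have hy : y ∈ Subalgebra.centralizer K {(L.map e).prod} := by
      refine (htop ▸ Algebra.adjoin_le ?_ : ⊤ ≤ Subalgebra.centralizer K {(L.map e).prod})
        Algebra.mem_top
      rintro _ ⟨i, rfl⟩
      rw [SetLike.mem_coe, Subalgebra.mem_centralizer_iff]
      rintro _ rfl
      rw [mul_prod_map_of_anticommute (K := K) hanti, List.count_eq_one_of_mem hnodup (hmem i),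
        hodd.add_one.neg_one_pow, one_smul]
    exact (Subalgebra.mem_centralizer_iff K |>.1 hy _ rfl).symm

end Anticommuting

theorem nonempty_adjoin_algEquiv_complex {A : Type*} [Ring A] [Nontrivial A] [Algebra ℝ A] {a : A}
    (ha : a * a = -1) : Nonempty (Algebra.adjoin ℝ {a} ≃ₐ[ℝ] ℂ) := by
  let f : ℂ →ₐ[ℝ] A := Complex.lift ⟨a, ha⟩
  have hf : f.range = Algebra.adjoin ℝ {a} := by
    rw [← Algebra.map_top, ← Complex.adjoin_I, AlgHom.map_adjoin, Set.image_singleton]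
    simp [f]
  exact ⟨((AlgEquiv.ofInjective f f.toRingHom.injective).trans
    (Subalgebra.equivOfEq _ _ hf)).symm⟩

section Qpq

variable (p q : ℕ)

theorem Qpq_single (i : Fin (p + q)) :
    Qpq p q (Pi.single i 1) = if (i : ℕ) < p then 1 else -1 := by
  simp [Qpq, QuadraticMap.weightedSumSquares_apply, Pi.single_apply]

theorem isOrtho_Qpq_single {i j : Fin (p + q)} (h : i ≠ j) :
    (Qpq p q).IsOrtho (Pi.single i 1) (Pi.single j 1) := by
  simp only [QuadraticMap.isOrtho_def, Qpq, QuadraticMap.weightedSumSquares_apply,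
    ← Finset.sum_add_distrib, Pi.add_apply]
  refine Finset.sum_congr rfl fun k _ => ?_
  rcases eq_or_ne k i with rfl | hk
  · simp [h]
  · simp [hk]

theorem adjoin_range_ι_Qpq_single :
    Algebra.adjoin ℝ (Set.range fun i : Fin (p + q) => ι (Qpq p q) (Pi.single i 1)) = ⊤ := by
  rw [eq_top_iff, ← CliffordAlgebra.adjoin_range_ι]
  refine Algebra.adjoin_le ?_
  rintro _ ⟨v, rfl⟩
  rw [← Finset.univ_sum_single v, map_sum]
  refine sum_mem fun i _ => ?_
  have hv : Pi.single i (v i) = v i • (Pi.single i 1 : Fin (p + q) → ℝ) := by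
    rw [← Pi.single_smul', smul_eq_mul, mul_one]
  rw [hv, map_smul]
  exact Subalgebra.smul_mem _ (Algebra.subset_adjoin (Set.mem_range_self i)) _

theorem omegaPQ_eq_prod_map :
    omegaPQ p q =
      ((List.finRange (p + q)).map fun i => ι (Qpq p q) (Pi.single i 1)).prod := by
  rw [omegaPQ, List.ofFn_eq_map]

theorem omegaPQ_mul_self :
    omegaPQ p q * omegaPQ p q = algebraMap ℝ _ ((-1) ^ ((p + q).choose 2 + q)) := by
  rw [omegaPQ_eq_prod_map, prod_map_mul_self_of_nodup
    (fun i j h => ι_mul_ι_comm_of_isOrtho (isOrtho_Qpq_single p q h))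
    (fun i => ι_sq_scalar _ _) (List.nodup_finRange _), List.length_finRange,
    ← List.ofFn_eq_map, List.prod_ofFn, Fin.prod_univ_add, pow_add]
  simp [Qpq_single]

end Qpq

theorem odd_choose_two_add {p q : ℕ} (hsig : ((p : ℤ) - q) % 4 = 3) :
    Odd ((p + q).choose 2 + q) := by
  rw [Nat.choose_two_right]
  obtain ⟨k, hk⟩ : ∃ k, p + q = 2 * k + 1 := ⟨(p + q) / 2, by omega⟩
  rw [hk, Nat.add_sub_cancel, mul_left_comm, Nat.mul_div_cancel_left _ two_pos]
  have hkq : Odd (k + q) := by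
    rw [Nat.odd_iff]
    omega
  grind

theorem stmt_14 (p q : ℕ) (hodd : Odd (p + q))
    (hsig : ((p : ℤ) - q) % 8 = 3 ∨ ((p : ℤ) - q) % 8 = 7) :
    Subalgebra.center ℝ (CliffordAlgebra (Qpq p q)) = Algebra.adjoin ℝ {omegaPQ p q} ∧
    Nonempty ((Algebra.adjoin ℝ {omegaPQ p q} :
      Subalgebra ℝ (CliffordAlgebra (Qpq p q))) ≃ₐ[ℝ] ℂ) := by
  constructor
  · rw [omegaPQ_eq_prod_map]
    refine center_eq_adjoin_prod_map
      (fun i j h => ι_mul_ι_comm_of_isOrtho (isOrtho_Qpq_single p q h))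
      (fun i => ι_sq_scalar _ _) (fun i => ?_) (adjoin_range_ι_Qpq_single p q)
      (List.nodup_finRange _) List.mem_finRange (by rwa [List.length_finRange])
    rw [Qpq_single]
    split_ifs <;> norm_num
  · refine nonempty_adjoin_algEquiv_complex ?_
    rw [omegaPQ_mul_self, (odd_choose_two_add (by omega)).neg_one_pow, map_neg, map_one]
end

section
/- For all natural numbers p, q there is a multiplicative (monoid) isomorphism spinGroup Q_{p,q} ≃* spinGroup Q_{q,p}; that is, the Spin groups of the quadratic forms of signature (p,q) and (q,p) are isomorphic. -/
open CliffordAlgebra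

namespace CliffordAlgebra

section CommRing

variable {R M M' : Type*} [CommRing R] [AddCommGroup M] [Module R M] [AddCommGroup M'] [Module R M']
variable {Q : QuadraticForm R M} {Q' : QuadraticForm R M'}

theorem star_mem_even {x : CliffordAlgebra Q} (hx : x ∈ even Q) : star x ∈ even Q := by
  rw [← Subalgebra.mem_toSubmodule, even_toSubmodule] at hx ⊢
  simpa only [star_def, reverse_mem_evenOdd_iff, involute_mem_evenOdd_iff] using hx

/-- The map of even subalgebras induced by a linear map `f` carrying `Q` to `-Q'`; it sends a
product of two vectors `v * w` to `-(f v * f w)`. -/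
def evenMapNeg (f : M →ₗ[R] M') (h : ∀ m, Q' (f m) = -Q m) : even Q →ₐ[R] even Q' :=
  even.lift Q
    { bilin := -((even.ι Q').bilin.compl₁₂ f f)
      contract := fun m => by
        simp only [LinearMap.neg_apply, LinearMap.compl₁₂_apply, EvenHom.contract, h, map_neg,
          neg_neg]
      contract_mid := fun m₁ m₂ m₃ => by
        simp only [LinearMap.neg_apply, LinearMap.compl₁₂_apply, neg_mul_neg,
          EvenHom.contract_mid, h, smul_neg, neg_smul] }

theorem evenMapNeg_ι (f : M →ₗ[R] M') (h : ∀ m, Q' (f m) = -Q m) (m₁ m₂ : M) :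
    evenMapNeg f h ((even.ι Q).bilin m₁ m₂) = -(even.ι Q').bilin (f m₁) (f m₂) :=
  even.lift_ι _ _ m₁ m₂

theorem coe_evenMapNeg_ι_mul_ι (f : M →ₗ[R] M') (h : ∀ m, Q' (f m) = -Q m) (m₁ m₂ : M)
    (hm : ι Q m₁ * ι Q m₂ ∈ even Q) :
    (evenMapNeg f h ⟨ι Q m₁ * ι Q m₂, hm⟩ : CliffordAlgebra Q') =
      -(ι Q' (f m₁) * ι Q' (f m₂)) :=
  congrArg Subtype.val (evenMapNeg_ι f h m₁ m₂)

theorem evenMapNeg_comp_evenMapNeg (f : M ≃ₗ[R] M') (h : ∀ m, Q' (f m) = -Q m)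
    (h' : ∀ m, Q (f.symm m) = -Q' m) :
    (evenMapNeg f.symm.toLinearMap h').comp (evenMapNeg f.toLinearMap h) =
      AlgHom.id R (even Q) := by
  ext m₁ m₂ : 4
  simp [evenMapNeg_ι]

theorem coe_evenMapNeg_star (f : M →ₗ[R] M') (h : ∀ m, Q' (f m) = -Q m)
    (x : CliffordAlgebra Q) (hx : x ∈ even Q) :
    (evenMapNeg f h ⟨star x, star_mem_even hx⟩ : CliffordAlgebra Q') =
      star (evenMapNeg f h ⟨x, hx⟩ : CliffordAlgebra Q') := by
  induction x, hx using even_induction with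
  | algebraMap r =>
    have e₁ : (⟨algebraMap R _ r, SetLike.algebraMap_mem_graded _ _⟩ : even Q) =
      algebraMap R (even Q) r := rfl
    have e₂ : (⟨star (algebraMap R _ r), star_mem_even (SetLike.algebraMap_mem_graded _ _)⟩ :
      even Q) = algebraMap R (even Q) r := Subtype.ext (star_algebraMap r)
    rw [e₂]
    refine Eq.trans ?_
      (congrArg (fun y : even Q => star (evenMapNeg f h y : CliffordAlgebra Q')) e₁.symm)
    simp only [AlgHom.commutes, Subalgebra.coe_algebraMap, star_algebraMap]
  | add x y hx hy ihx ihy =>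
    have e₁ : (⟨x + y, Submodule.add_mem _ hx hy⟩ : even Q) = ⟨x, hx⟩ + ⟨y, hy⟩ := rfl
    have e₂ : (⟨star (x + y), star_mem_even (Submodule.add_mem _ hx hy)⟩ : even Q) =
      ⟨star x, star_mem_even hx⟩ + ⟨star y, star_mem_even hy⟩ := Subtype.ext (star_add x y)
    rw [e₂]
    refine Eq.trans ?_
      (congrArg (fun y : even Q => star (evenMapNeg f h y : CliffordAlgebra Q')) e₁.symm)
    simp only [map_add, Subalgebra.coe_add, star_add, ihx, ihy]
  | ι_mul_ι_mul m₁ m₂ x hx ih =>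
    have hm (a b : M) : ι Q a * ι Q b ∈ even Q := ι_mul_ι_mem_evenOdd_zero Q a b
    have e₁ : (⟨ι Q m₁ * ι Q m₂ * x, mul_mem (hm m₁ m₂) hx⟩ : even Q) =
      ⟨ι Q m₁ * ι Q m₂, hm m₁ m₂⟩ * ⟨x, hx⟩ := rfl
    have e₂ : (⟨star (ι Q m₁ * ι Q m₂ * x), star_mem_even (mul_mem (hm m₁ m₂) hx)⟩ : even Q) =
        ⟨star x, star_mem_even hx⟩ * ⟨ι Q m₂ * ι Q m₁, hm m₂ m₁⟩ :=
      Subtype.ext (by simp [star_ι])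
    rw [e₂]
    refine Eq.trans ?_
      (congrArg (fun y : even Q => star (evenMapNeg f h y : CliffordAlgebra Q')) e₁.symm)
    simp only [map_mul, Subalgebra.coe_mul, coe_evenMapNeg_ι_mul_ι, star_mul, star_neg, star_ι, ih,
      neg_mul_neg]

end CommRing

section Field

variable {K M M' : Type*} [Field K] [AddCommGroup M] [Module K M]
  [AddCommGroup M'] [Module K M']
variable {Q : QuadraticForm K M} {Q' : QuadraticForm K M'}

theorem exists_unit_eq_ι {m : M} (hm : Q m ≠ 0) :
    ∃ u ∈ lipschitzGroup Q, (u : CliffordAlgebra Q) = ι Q m := by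
  let := invertibleOfNonzero hm
  let := invertibleιOfInvertible Q m
  exact ⟨unitOfInvertible (ι Q m), Subgroup.subset_closure ⟨m, rfl⟩, rfl⟩

/-- The even elements whose image under `evenMapNeg` lies in the Lipschitz group. -/
def evenLipschitz (f : M →ₗ[K] M') (h : ∀ m, Q' (f m) = -Q m) : Submonoid (even Q) :=
  ((lipschitzGroup Q').toSubmonoid.map (Units.coeHom (CliffordAlgebra Q'))).comap
    ((even Q').val.comp (evenMapNeg f h) : even Q →* CliffordAlgebra Q')

theorem ι_mul_ι_mem_evenLipschitz (f : M →ₗ[K] M') (h : ∀ m, Q' (f m) = -Q m) {a b : M}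
    (ha : Q a ≠ 0) (hb : Q b ≠ 0) :
    (⟨ι Q a * ι Q b, ι_mul_ι_mem_evenOdd_zero Q a b⟩ : even Q) ∈ evenLipschitz f h := by
  obtain ⟨u, hu, hu'⟩ := exists_unit_eq_ι (Q := Q') (m := -f a) (by simpa [h] using ha)
  obtain ⟨v, hv, hv'⟩ := exists_unit_eq_ι (Q := Q') (m := f b) (by simpa [h] using hb)
  refine ⟨u * v, mul_mem hu hv, ?_⟩
  refine Eq.trans ?_ (coe_evenMapNeg_ι_mul_ι f h a b (ι_mul_ι_mem_evenOdd_zero Q a b)).symm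
  simp [hu', hv']

variable [Invertible (2 : K)]

theorem ne_zero_of_isUnit_ι {m : M} (hm : IsUnit (ι Q m)) : Q m ≠ 0 :=
  ((isUnit_ι_iff (Q := Q)).1 hm).ne_zero

theorem inv_mem_range_ι {u : (CliffordAlgebra Q)ˣ}
    (hu : (u : CliffordAlgebra Q) ∈ Set.range (ι Q)) :
    ((u⁻¹ : (CliffordAlgebra Q)ˣ) : CliffordAlgebra Q) ∈ Set.range (ι Q) := by
  obtain ⟨m, hm⟩ := hu
  have h0 : Q m ≠ 0 := ne_zero_of_isUnit_ι (hm ▸ u.isUnit)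
  refine ⟨(Q m)⁻¹ • m, ?_⟩
  rw [eq_comm, Units.inv_eq_of_mul_eq_one_right]
  rw [← hm, map_smul, mul_smul_comm, ι_sq_scalar, Algebra.algebraMap_eq_smul_one, smul_smul,
    inv_mul_cancel₀ h0, one_smul]

/-- Every element of the Lipschitz group is either an even product of vectors, or such a product
times one more vector. -/
theorem lipschitzGroup_even_or_odd (f : M →ₗ[K] M') (h : ∀ m, Q' (f m) = -Q m)
    {x : (CliffordAlgebra Q)ˣ} (hx : x ∈ lipschitzGroup Q) :
    (∃ y ∈ evenLipschitz f h, (y : CliffordAlgebra Q) = x) ∨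
      ∃ y ∈ evenLipschitz f h, ∃ b, Q b ≠ 0 ∧ (y : CliffordAlgebra Q) * ι Q b = x := by
  have step : ∀ x y : (CliffordAlgebra Q)ˣ, (y : CliffordAlgebra Q) ∈ Set.range (ι Q) →
      ((∃ y ∈ evenLipschitz f h, (y : CliffordAlgebra Q) = x) ∨
        ∃ y ∈ evenLipschitz f h, ∃ b, Q b ≠ 0 ∧ (y : CliffordAlgebra Q) * ι Q b = x) →
      ((∃ z ∈ evenLipschitz f h, (z : CliffordAlgebra Q) = (x * y : (CliffordAlgebra Q)ˣ)) ∨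
        ∃ z ∈ evenLipschitz f h, ∃ b, Q b ≠ 0 ∧
          (z : CliffordAlgebra Q) * ι Q b = (x * y : (CliffordAlgebra Q)ˣ)) := by
    rintro x y ⟨a, ha⟩ hxy
    have h0 : Q a ≠ 0 := ne_zero_of_isUnit_ι (ha ▸ y.isUnit)
    rcases hxy with ⟨z, hz, hzx⟩ | ⟨z, hz, b, hb, hzx⟩
    · exact Or.inr ⟨z, hz, a, h0, by rw [hzx, ha, Units.val_mul]⟩
    · refine Or.inl ⟨_, mul_mem hz (ι_mul_ι_mem_evenLipschitz f h hb h0), ?_⟩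
      rw [Subalgebra.coe_mul, Units.val_mul, ← hzx, ← ha, mul_assoc]
  unfold lipschitzGroup at hx
  induction hx using Subgroup.closure_induction_right with
  | one => exact Or.inl ⟨1, one_mem _, rfl⟩
  | mul_right x _ y hy ih => exact step x y hy ih
  | mul_inv_cancel x _ y hy ih => exact step x y⁻¹ (inv_mem_range_ι hy) ih

theorem mem_evenLipschitz_of_mem_lipschitzGroup (f : M →ₗ[K] M') (h : ∀ m, Q' (f m) = -Q m)
    {x : CliffordAlgebra Q}
    (hx : x ∈ (lipschitzGroup Q).toSubmonoid.map (Units.coeHom (CliffordAlgebra Q)))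
    (he : x ∈ even Q) : (⟨x, he⟩ : even Q) ∈ evenLipschitz f h := by
  obtain ⟨u, hu, rfl⟩ := hx
  rcases lipschitzGroup_even_or_odd f h hu with ⟨y, hy, hyx⟩ | ⟨y, hy, b, -, hyx⟩
  · convert hy
    exact hyx.symm
  · have h₁ : involute (u : CliffordAlgebra Q) = u := involute_eq_of_mem_even he
    have h₂ : involute (u : CliffordAlgebra Q) = -u := by
      rw [← hyx, map_mul, involute_ι, involute_eq_of_mem_even y.2, mul_neg]
    have h₃ : (2 : K) • (u : CliffordAlgebra Q) = 0 := by
      rw [two_smul]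
      nth_rewrite 1 [← h₁]
      rw [h₂, neg_add_cancel]
    exact absurd ((smul_eq_zero_iff_right (Invertible.ne_zero (2 : K))).1 h₃) u.ne_zero

theorem evenMapNeg_mem_spinGroup (f : M →ₗ[K] M') (h : ∀ m, Q' (f m) = -Q m)
    {x : CliffordAlgebra Q} (hx : x ∈ spinGroup Q) :
    (evenMapNeg f h ⟨x, spinGroup.mem_even hx⟩ : CliffordAlgebra Q') ∈ spinGroup Q' := by
  have he := spinGroup.mem_even hx
  refine ⟨⟨mem_evenLipschitz_of_mem_lipschitzGroup f h hx.1.1 he, ?_⟩, Subtype.property _⟩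
  rw [SetLike.mem_coe, Unitary.mem_iff, ← coe_evenMapNeg_star f h x he,
    ← Subalgebra.coe_mul, ← Subalgebra.coe_mul, ← map_mul, ← map_mul]
  have e₁ : (⟨star x, star_mem_even he⟩ * ⟨x, he⟩ : even Q) = 1 :=
    Subtype.ext (spinGroup.star_mul_self_of_mem hx)
  have e₂ : (⟨x, he⟩ * ⟨star x, star_mem_even he⟩ : even Q) = 1 :=
    Subtype.ext (spinGroup.mul_star_self_of_mem hx)
  rw [e₁, e₂, map_one]
  exact ⟨rfl, rfl⟩

/-- The homomorphism of spin groups induced by a linear map carrying `Q` to `-Q'`. -/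
def spinGroupMapNeg (f : M →ₗ[K] M') (h : ∀ m, Q' (f m) = -Q m) :
    spinGroup Q →* spinGroup Q' where
  toFun x := ⟨evenMapNeg f h ⟨x, spinGroup.mem_even x.2⟩, evenMapNeg_mem_spinGroup f h x.2⟩
  map_one' := Subtype.ext (congrArg (fun y : even Q' => (y : CliffordAlgebra Q'))
    (map_one (evenMapNeg f h)))
  map_mul' x y := Subtype.ext (congrArg (fun y : even Q' => (y : CliffordAlgebra Q'))
    (map_mul (evenMapNeg f h) ⟨x, spinGroup.mem_even x.2⟩ ⟨y, spinGroup.mem_even y.2⟩))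

theorem spinGroupMapNeg_comp_spinGroupMapNeg (f : M ≃ₗ[K] M') (h : ∀ m, Q' (f m) = -Q m)
    (h' : ∀ m, Q (f.symm m) = -Q' m) :
    (spinGroupMapNeg f.symm.toLinearMap h').comp (spinGroupMapNeg f.toLinearMap h) =
      MonoidHom.id (spinGroup Q) := by
  ext x
  exact congrArg (even Q).val
    (AlgHom.congr_fun (evenMapNeg_comp_evenMapNeg f h h') ⟨x, spinGroup.mem_even x.2⟩)

/-- A linear equivalence carrying `Q` to `-Q'` induces an isomorphism of spin groups. -/
def spinGroupEquivNeg (f : M ≃ₗ[K] M') (h : ∀ m, Q' (f m) = -Q m) :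
    spinGroup Q ≃* spinGroup Q' :=
  have h' : ∀ m, Q (f.symm m) = -Q' m := fun m => by
    rw [← f.apply_symm_apply m, h, neg_neg, f.symm_apply_apply]
  MonoidHom.toMulEquiv (spinGroupMapNeg f.toLinearMap h) (spinGroupMapNeg f.symm.toLinearMap h')
    (spinGroupMapNeg_comp_spinGroupMapNeg f h h')
    (spinGroupMapNeg_comp_spinGroupMapNeg f.symm h' h)

end Field

end CliffordAlgebra

/-- The order-reversing bijection of coordinates exchanges the positive and negative parts. -/
theorem Qpq_funCongrLeft_rev (p q : ℕ) (v : Fin (p + q) → ℝ) :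
    Qpq q p (LinearEquiv.funCongrLeft ℝ ℝ ((finCongr (add_comm q p)).trans Fin.revPerm) v) =
      -Qpq p q v := by
  simp only [Qpq, QuadraticMap.weightedSumSquares_apply, ← Finset.sum_neg_distrib]
  refine Fintype.sum_equiv ((finCongr (add_comm q p)).trans Fin.revPerm) _ _ fun i => ?_
  have hi := i.isLt
  by_cases hq : (i : ℕ) < q
  · have : ¬ p + q - ((i : ℕ) + 1) < p := by omega
    simp [LinearEquiv.funCongrLeft_apply, LinearMap.funLeft_apply, hq, this]
  · have : p + q - ((i : ℕ) + 1) < p := by omega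
    simp [LinearEquiv.funCongrLeft_apply, LinearMap.funLeft_apply, hq, this]

theorem stmt_18 (p q : ℕ) :
    Nonempty (spinGroup (Qpq p q) ≃* spinGroup (Qpq q p)) := by
  exact ⟨spinGroupEquivNeg _ (Qpq_funCongrLeft_rev p q)⟩
end
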